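/- For every b ∈ PC(Γ), the stationary Fokker–Planck problem on Γ associated with b has at most one solution: if m and m' are both solutions, then m_α = m'_α on [0, ℓ_α] for every α ∈ 𝒜. -/

import Mathlib

open Set

/-- A connected network: finite vertex set `I`, finite edge set `A`, each edge `α`
identified with `[0, ℓ α]`, with endpoint `0` attached to `src α` and endpoint `ℓ α`
attached to `tgt α`, these being distinct vertices; the resulting graph is connected. -/
structure Network (I A : Type) [Fintype I] [Fintype A] [DecidableEq I] where
  ℓ : A → ℝ
  ℓ_pos : ∀ α, 0 < ℓ α
  src : A → I
  tgt : A → I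
  src_ne_tgt : ∀ α, src α ≠ tgt α
  connected : ∀ i j : I,
    Relation.ReflTransGen
      (fun i j => ∃ α, (src α = i ∧ tgt α = j) ∨ (src α = j ∧ tgt α = i)) i j

namespace Network

variable {I A : Type} [Fintype I] [Fintype A] [DecidableEq I]

/-- The set `𝒜_i` of edges incident to the vertex `i`. -/
def edges (N : Network I A) (i : I) : Finset A :=
  Finset.univ.filter fun α => N.src α = i ∨ N.tgt α = i

/-- The value `f|_α(ν_i)` of an edgewise family `f` at the vertex `i` along the edge `α`. -/
def vval (N : Network I A) (f : A → ℝ → ℝ) (i : I) (α : A) : ℝ :=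
  if N.src α = i then f α 0 else f α (N.ℓ α)

/-- The outward directional derivative `∂_α f(ν_i)`, expressed via the family `f'` of
edgewise first derivatives. -/
def oderiv (N : Network I A) (f' : A → ℝ → ℝ) (i : I) (α : A) : ℝ :=
  if N.src α = i then -(f' α 0) else f' α (N.ℓ α)

/-- The sign `n_{iα}`: `-1` if `ν_i` is attached to the endpoint `0` of `α`, `+1` if it is
attached to the endpoint `ℓ α`. -/
def sgn (N : Network I A) (i : I) (α : A) : ℝ :=
  if N.src α = i then -1 else 1

/-- `v = (v_α)` is a `C²` function on the network, with first derivatives `v'` and second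
derivatives `v''`, continuous at the vertices. -/
def IsC2 (N : Network I A) (v v' v'' : A → ℝ → ℝ) : Prop :=
  (∀ α, ∀ y ∈ Icc (0:ℝ) (N.ℓ α), HasDerivWithinAt (v α) (v' α y) (Icc 0 (N.ℓ α)) y) ∧
  (∀ α, ∀ y ∈ Icc (0:ℝ) (N.ℓ α), HasDerivWithinAt (v' α) (v'' α y) (Icc 0 (N.ℓ α)) y) ∧
  (∀ α, ContinuousOn (v'' α) (Icc 0 (N.ℓ α))) ∧
  (∀ i : I, ∀ α ∈ N.edges i, ∀ β ∈ N.edges i, N.vval v i α = N.vval v i β)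

/-- The Kirchhoff conditions `∑_{α ∈ 𝒜_i} γ_{iα} μ_α ∂_α v(ν_i) = 0` at every vertex. -/
def Kirchhoff (N : Network I A) (μ : A → ℝ) (γ : I → A → ℝ) (v' : A → ℝ → ℝ) : Prop :=
  ∀ i : I, ∑ α ∈ N.edges i, γ i α * μ α * N.oderiv v' i α = 0

end Network

namespace Network

variable {I A : Type} [Fintype I] [Fintype A] [DecidableEq I]

/-- A solution of the stationary Fokker–Planck problem on the network associated with the
drift `b`: `m` (with edgewise derivative `m'`) is `C¹` on each edge, satisfies the jump
conditions `m|_α(ν_i)/γ_{iα} = m|_β(ν_i)/γ_{iβ}`, the first integral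
`μ_α m_α' + b_α m_α = c_α` on each edge, the vertex transmission conditions
`∑_{α ∈ 𝒜_i} [n_{iα} b|_α(ν_i) m|_α(ν_i) + μ_α ∂_α m(ν_i)] = 0`, is nonnegative and has
total integral `1`. -/
def IsFPSolution (N : Network I A) (μ : A → ℝ) (γ : I → A → ℝ)
    (b : A → ℝ → ℝ) (m m' : A → ℝ → ℝ) : Prop :=
  (∀ α, ∀ y ∈ Icc (0:ℝ) (N.ℓ α), HasDerivWithinAt (m α) (m' α y) (Icc 0 (N.ℓ α)) y) ∧
  (∀ α, ContinuousOn (m' α) (Icc 0 (N.ℓ α))) ∧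
  (∀ i : I, ∀ α ∈ N.edges i, ∀ β ∈ N.edges i,
      N.vval m i α / γ i α = N.vval m i β / γ i β) ∧
  (∀ α, ∃ c : ℝ, ∀ y ∈ Icc (0:ℝ) (N.ℓ α), μ α * m' α y + b α y * m α y = c) ∧
  (∀ i : I, ∑ α ∈ N.edges i,
      (N.sgn i α * N.vval b i α * N.vval m i α + μ α * N.oderiv m' i α) = 0) ∧
  (∀ α, ∀ y ∈ Icc (0:ℝ) (N.ℓ α), 0 ≤ m α y) ∧
  (∑ α : A, ∫ y in (0:ℝ)..(N.ℓ α), m α y) = 1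

/-- The standing assumptions on the Hamiltonians `H_α : [0, ℓ_α] × ℝ → ℝ` with partial
derivatives `Hp_α = ∂_p H_α`: `C¹` regularity, convexity in `p`, coercivity
`H_α(x,p) ≥ C₀|p|^q − C₁` and the growth condition `|∂_p H_α(x,p)| ≤ C₂(|p|^{q−1} + 1)`. -/
def HamHyp (N : Network I A) (H Hp : A → ℝ → ℝ → ℝ) (q C0 C1 C2 : ℝ) : Prop :=
  (∀ α, ContDiffOn ℝ 1 (fun z : ℝ × ℝ => H α z.1 z.2)
      (Icc (0:ℝ) (N.ℓ α) ×ˢ (univ : Set ℝ))) ∧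
  (∀ α, ∀ x ∈ Icc (0:ℝ) (N.ℓ α), ∀ p : ℝ, HasDerivAt (fun p => H α x p) (Hp α x p) p) ∧
  (∀ α, ∀ x ∈ Icc (0:ℝ) (N.ℓ α), ConvexOn ℝ univ (fun p => H α x p)) ∧
  (∀ α, ∀ x ∈ Icc (0:ℝ) (N.ℓ α), ∀ p : ℝ, C0 * |p| ^ q - C1 ≤ H α x p) ∧
  (∀ α, ∀ x ∈ Icc (0:ℝ) (N.ℓ α), ∀ p : ℝ, |Hp α x p| ≤ C2 * (|p| ^ (q - 1) + 1))

/-- A solution `(v, m, ρ)` of the stationary MFG system on the network: `v` is `C²`,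
solves the ergodic HJB equation with coupling `F(m)` and the Kirchhoff conditions; `m` is
`C¹` on each edge, satisfies the jump conditions, the first-integral form of the
Fokker–Planck equation `μ_α m_α' + m_α ∂_p H_α(·, v_α') = c_α` with `∑_{α∈𝒜_i} n_{iα} c_α = 0`
at every vertex, `m ≥ 0`, `∫_Γ m = 1` and `∫_Γ v = 0`. -/
def IsMFGSolution (N : Network I A) (μ : A → ℝ) (γ : I → A → ℝ)
    (H Hp : A → ℝ → ℝ → ℝ) (F : ℝ → ℝ)
    (v v' v'' m m' : A → ℝ → ℝ) (ρ : ℝ) : Prop :=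
  IsC2 N v v' v'' ∧
  (∀ α, ∀ y ∈ Ioo (0:ℝ) (N.ℓ α),
      -(μ α * v'' α y) + H α y (v' α y) + ρ = F (m α y)) ∧
  Kirchhoff N μ γ v' ∧
  (∀ α, ∀ y ∈ Icc (0:ℝ) (N.ℓ α), HasDerivWithinAt (m α) (m' α y) (Icc 0 (N.ℓ α)) y) ∧
  (∀ α, ContinuousOn (m' α) (Icc 0 (N.ℓ α))) ∧
  (∀ i : I, ∀ α ∈ N.edges i, ∀ β ∈ N.edges i,
      N.vval m i α / γ i α = N.vval m i β / γ i β) ∧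
  (∃ c : A → ℝ,
    (∀ α, ∀ y ∈ Icc (0:ℝ) (N.ℓ α), μ α * m' α y + m α y * Hp α y (v' α y) = c α) ∧
    (∀ i : I, ∑ α ∈ N.edges i, N.sgn i α * c α = 0)) ∧
  (∀ α, ∀ y ∈ Icc (0:ℝ) (N.ℓ α), 0 ≤ m α y) ∧
  (∑ α : A, ∫ y in (0:ℝ)..(N.ℓ α), m α y) = 1 ∧
  (∑ α : A, ∫ y in (0:ℝ)..(N.ℓ α), v α y) = 0

end Network

/-- Integrating factor for the scalar equation `μ f' + b f = c` on `[0, ℓ]`. -/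
theorem exists_integratingFactor {ℓ μ c : ℝ} (hℓ : 0 < ℓ) (hμ : 0 < μ) {b f f' : ℝ → ℝ}
    (hb : ContinuousOn b (Icc 0 ℓ))
    (hf : ∀ y ∈ Icc (0:ℝ) ℓ, HasDerivWithinAt f (f' y) (Icc 0 ℓ) y)
    (hc : ∀ y ∈ Icc (0:ℝ) ℓ, μ * f' y + b y * f y = c) :
    ∃ E K : ℝ → ℝ, (∀ y, 0 < E y) ∧ 0 < K ℓ ∧
      ∀ y ∈ Icc (0:ℝ) ℓ, E y * f y = f 0 + c * K y := by
  set B : ℝ → ℝ := IccExtend hℓ.le ((Icc 0 ℓ).domRestrict b) with hB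
  have hBcont : Continuous fun y => B y / μ :=
    (continuous_IccExtend_iff.2 hb.domRestrict).div_const μ
  have hBb : ∀ y ∈ Icc (0:ℝ) ℓ, B y = b y := fun y hy => by
    simp [hB, IccExtend_of_mem _ _ hy]
  set E : ℝ → ℝ := fun y => Real.exp (∫ t in (0:ℝ)..y, B t / μ) with hE
  have hEderiv : ∀ y, HasDerivAt E (E y * (B y / μ)) y := fun y =>
    (hBcont.integral_hasStrictDerivAt 0 y).hasDerivAt.exp
  have hEcont : Continuous fun y => E y / μ :=
    (continuous_iff_continuousAt.2 fun y => (hEderiv y).continuousAt).div_const μ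
  have hEpos : ∀ y, 0 < E y := fun y => Real.exp_pos _
  set K : ℝ → ℝ := fun y => ∫ t in (0:ℝ)..y, E t / μ with hK
  have hKderiv : ∀ y, HasDerivAt K (E y / μ) y := fun y =>
    (hEcont.integral_hasStrictDerivAt 0 y).hasDerivAt
  have hderiv : ∀ y ∈ Icc (0:ℝ) ℓ,
      HasDerivWithinAt (fun y => E y * f y - c * K y) 0 (Icc 0 ℓ) y := fun y hy => by
    have h := ((hEderiv y).hasDerivWithinAt.mul (hf y hy)).sub
      ((hKderiv y).hasDerivWithinAt.const_mul c)
    refine h.congr_deriv ?_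
    rw [← hc y hy, hBb y hy]
    field_simp
    ring
  refine ⟨E, K, hEpos, ?_, fun y hy => ?_⟩
  · exact intervalIntegral.intervalIntegral_pos_of_pos (hEcont.intervalIntegrable _ _)
      (fun y => div_pos (hEpos y) hμ) hℓ
  · have h := constant_of_has_deriv_right_zero (fun y hy => (hderiv y hy).continuousWithinAt)
      (fun y hy => (hderiv y (Ico_subset_Icc_self hy)).mono_of_mem_nhdsWithin
        (Icc_mem_nhdsGE_of_mem hy)) y hy
    have hE0 : E 0 = 1 := by simp [hE]
    have hK0 : K 0 = 0 := by simp [hK]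
    simp only [hE0, hK0] at h
    linarith

namespace Network

variable {I A : Type} [Fintype I] [Fintype A] [DecidableEq I]

theorem mem_edges {N : Network I A} {i : I} {α : A} :
    α ∈ N.edges i ↔ N.src α = i ∨ N.tgt α = i := by
  simp [edges]

theorem vval_sub_mul (N : Network I A) (f g : A → ℝ → ℝ) (t : ℝ) (i : I) (α : A) :
    N.vval (fun α y => f α y - t * g α y) i α = N.vval f i α - t * N.vval g i α := by
  unfold vval; split_ifs <;> rfl

theorem vval_nonneg (N : Network I A) {f : A → ℝ → ℝ}
    (hf : ∀ α, ∀ y ∈ Icc (0:ℝ) (N.ℓ α), 0 ≤ f α y) (i : I) (α : A) : 0 ≤ N.vval f i α := by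
  have hℓ := (N.ℓ_pos α).le
  unfold vval
  split_ifs
  · exact hf α 0 ⟨le_rfl, hℓ⟩
  · exact hf α _ ⟨hℓ, le_rfl⟩

/-- The linear part of the stationary Fokker–Planck problem, with edge fluxes `c`. -/
structure IsFPLinear (N : Network I A) (μ : A → ℝ) (γ : I → A → ℝ)
    (b m m' : A → ℝ → ℝ) (c : A → ℝ) : Prop where
  deriv : ∀ α, ∀ y ∈ Icc (0:ℝ) (N.ℓ α), HasDerivWithinAt (m α) (m' α y) (Icc 0 (N.ℓ α)) y
  jump : ∀ i : I, ∀ α ∈ N.edges i, ∀ β ∈ N.edges i,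
    N.vval m i α / γ i α = N.vval m i β / γ i β
  flux : ∀ α, ∀ y ∈ Icc (0:ℝ) (N.ℓ α), μ α * m' α y + b α y * m α y = c α
  balance : ∀ i : I, ∑ α ∈ N.edges i, N.sgn i α * c α = 0

theorem IsFPSolution.exists_isFPLinear {N : Network I A} {μ : A → ℝ} {γ : I → A → ℝ}
    {b m m' : A → ℝ → ℝ} (h : N.IsFPSolution μ γ b m m') :
    ∃ c, N.IsFPLinear μ γ b m m' c := by
  obtain ⟨hd, -, hj, hf, hk, -, -⟩ := h
  choose c hc using hf
  refine ⟨c, hd, hj, hc, fun i => ?_⟩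
  rw [← hk i]
  refine Finset.sum_congr rfl fun α _ => ?_
  have hℓ := (N.ℓ_pos α).le
  unfold sgn vval oderiv
  split_ifs
  · rw [← hc α 0 ⟨le_rfl, hℓ⟩]; ring
  · rw [← hc α _ ⟨hℓ, le_rfl⟩]; ring

theorem IsFPLinear.sub_mul {N : Network I A} {μ : A → ℝ} {γ : I → A → ℝ}
    {b m₁ m₁' m₂ m₂' : A → ℝ → ℝ} {c₁ c₂ : A → ℝ}
    (h₁ : N.IsFPLinear μ γ b m₁ m₁' c₁) (h₂ : N.IsFPLinear μ γ b m₂ m₂' c₂) (t : ℝ) :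
    N.IsFPLinear μ γ b (fun α y => m₁ α y - t * m₂ α y) (fun α y => m₁' α y - t * m₂' α y)
      (fun α => c₁ α - t * c₂ α) where
  deriv α y hy := (h₁.deriv α y hy).sub ((h₂.deriv α y hy).const_mul t)
  jump i α hα β hβ := by
    simp only [vval_sub_mul, sub_div, mul_div_assoc, h₁.jump i α hα β hβ, h₂.jump i α hα β hβ]
  flux α y hy := by
    rw [← h₁.flux α y hy, ← h₂.flux α y hy]; ring
  balance i := by
    have : ∀ α, N.sgn i α * (c₁ α - t * c₂ α) = N.sgn i α * c₁ α - t * (N.sgn i α * c₂ α) :=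
      fun α => by ring
    simp only [this, Finset.sum_sub_distrib, ← Finset.mul_sum, h₁.balance i, h₂.balance i]
    simp

section Vanishing

variable {N : Network I A} {μ : A → ℝ} {γ : I → A → ℝ} {b m m' : A → ℝ → ℝ} {c : A → ℝ}

/-- A linear solution with nonnegative vertex values which vanishes at a vertex vanishes on every
edge incident to that vertex. -/
theorem IsFPLinear.eq_zero_of_mem_edges (h : N.IsFPLinear μ γ b m m' c) (hμ : ∀ α, 0 < μ α)
    (hb : ∀ α, ContinuousOn (b α) (Icc (0:ℝ) (N.ℓ α)))
    (hm : ∀ i, ∀ α ∈ N.edges i, 0 ≤ N.vval m i α) {i : I}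
    (hi : ∀ α ∈ N.edges i, N.vval m i α = 0) {α : A} (hα : α ∈ N.edges i) :
    ∀ y ∈ Icc (0:ℝ) (N.ℓ α), m α y = 0 := by
  choose E K hE hK hEK using fun α =>
    exists_integratingFactor (N.ℓ_pos α) (hμ α) (hb α) (h.deriv α) (h.flux α)
  have hend : ∀ β, E β (N.ℓ β) * m β (N.ℓ β) = m β 0 + c β * K β (N.ℓ β) := fun β =>
    hEK β _ ⟨(N.ℓ_pos β).le, le_rfl⟩
  have hsrc : ∀ β, 0 ≤ m β 0 := fun β => by
    simpa [vval] using hm (N.src β) β (mem_edges.2 (Or.inl rfl))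
  have htgt : ∀ β, 0 ≤ m β (N.ℓ β) := fun β => by
    simpa [vval, N.src_ne_tgt β] using hm (N.tgt β) β (mem_edges.2 (Or.inr rfl))
  have hle : ∀ β ∈ N.edges i, N.sgn i β * c β ≤ 0 := fun β hβ => by
    have hz := hi β hβ
    have he := hend β
    unfold vval at hz
    unfold sgn
    split_ifs at hz ⊢
    · have : 0 ≤ c β * K β (N.ℓ β) := by
        have := mul_nonneg (hE β (N.ℓ β)).le (htgt β)
        linarith
      linarith [nonneg_of_mul_nonneg_left this (hK β)]
    · have : 0 ≤ -c β * K β (N.ℓ β) := by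
        rw [hz] at he
        linarith [hsrc β]
      linarith [nonneg_of_mul_nonneg_left this (hK β)]
  have hc : c α = 0 := by
    have := (Finset.sum_eq_zero_iff_of_nonpos hle).1 (h.balance i) α hα
    unfold sgn at this
    split_ifs at this <;> linarith
  have h0 : m α 0 = 0 := by
    have hz := hi α hα
    have he := hend α
    unfold vval at hz
    split_ifs at hz
    · exact hz
    · rw [hz, hc] at he
      linarith
  intro y hy
  have := hEK α y hy
  rw [h0, hc] at this
  simpa [(hE α y).ne'] using this

/-- A linear solution with nonnegative vertex values, one of which is zero, vanishes. -/
theorem IsFPLinear.eq_zero (h : N.IsFPLinear μ γ b m m' c) (hμ : ∀ α, 0 < μ α)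
    (hγ : ∀ i : I, ∀ α ∈ N.edges i, 0 < γ i α)
    (hb : ∀ α, ContinuousOn (b α) (Icc (0:ℝ) (N.ℓ α)))
    (hm : ∀ i, ∀ α ∈ N.edges i, 0 ≤ N.vval m i α) {i : I} {α : A} (hα : α ∈ N.edges i)
    (hz : N.vval m i α = 0) :
    ∀ β, ∀ y ∈ Icc (0:ℝ) (N.ℓ β), m β y = 0 := by
  have hvertex : ∀ {j β}, β ∈ N.edges j → N.vval m j β = 0 →
      ∀ δ ∈ N.edges j, N.vval m j δ = 0 := fun {j β} hβ hjβ δ hδ => by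
    have := h.jump j β hβ δ hδ
    rw [hjβ, zero_div, eq_comm, div_eq_zero_iff] at this
    exact this.resolve_right (hγ j δ hδ).ne'
  have hall : ∀ j, ∀ δ ∈ N.edges j, N.vval m j δ = 0 := fun j => by
    induction N.connected i j with
    | refl => exact hvertex hα hz
    | @tail j k _ hjk ih =>
      obtain ⟨β, hβ⟩ := hjk
      have hβj : β ∈ N.edges j := mem_edges.2 (hβ.imp And.left And.right)
      have hβk : β ∈ N.edges k := mem_edges.2 (hβ.symm.imp And.left And.right)
      have hzero := h.eq_zero_of_mem_edges hμ hb hm ih hβj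
      refine hvertex hβk ?_
      have hℓ := (N.ℓ_pos β).le
      unfold vval
      split_ifs
      · exact hzero 0 ⟨le_rfl, hℓ⟩
      · exact hzero _ ⟨hℓ, le_rfl⟩
  intro β
  exact h.eq_zero_of_mem_edges hμ hb hm (hall (N.src β)) (mem_edges.2 (Or.inl rfl))

end Vanishing

end Network

/-- uniqueness of the solution of the stationary Fokker–Planck problem. -/
theorem stmt_5 {I A : Type} [Fintype I] [Fintype A] [DecidableEq I]
    (N : Network I A) (μ : A → ℝ) (γ : I → A → ℝ)
    (hμ : ∀ α, 0 < μ α) (hγ : ∀ i : I, ∀ α ∈ N.edges i, 0 < γ i α)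
    (b : A → ℝ → ℝ) (hb : ∀ α, ContinuousOn (b α) (Icc (0:ℝ) (N.ℓ α)))
    (m₁ m₁' m₂ m₂' : A → ℝ → ℝ)
    (h₁ : Network.IsFPSolution N μ γ b m₁ m₁')
    (h₂ : Network.IsFPSolution N μ γ b m₂ m₂') :
    ∀ α : A, ∀ y ∈ Icc (0:ℝ) (N.ℓ α), m₁ α y = m₂ α y := by
  obtain ⟨c₁, hL₁⟩ := h₁.exists_isFPLinear
  obtain ⟨c₂, hL₂⟩ := h₂.exists_isFPLinear
  obtain ⟨-, -, -, -, -, hn₁, hmass₁⟩ := h₁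
  obtain ⟨-, -, -, -, -, hn₂, hmass₂⟩ := h₂
  have hpos : ∀ i, ∀ α ∈ N.edges i, 0 < N.vval m₂ i α := fun i α hα => by
    refine (N.vval_nonneg hn₂ i α).lt_of_ne' fun hz => ?_
    have hzero := hL₂.eq_zero hμ hγ hb (fun i α _ => N.vval_nonneg hn₂ i α) hα hz
    refine zero_ne_one (hmass₂ ▸ (Finset.sum_eq_zero fun β _ => ?_).symm)
    rw [intervalIntegral.integral_congr (g := fun _ => (0:ℝ)), intervalIntegral.integral_zero]
    rw [uIcc_of_le (N.ℓ_pos β).le]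
    exact hzero β
  intro α₀
  obtain ⟨⟨i, α⟩, hiα, hmin⟩ := Finset.exists_min_image
    (Finset.univ.sigma fun i => N.edges i) (fun p => N.vval m₁ p.1 p.2 / N.vval m₂ p.1 p.2)
    ⟨⟨N.src α₀, α₀⟩, by simp [Network.mem_edges]⟩
  have hα : α ∈ N.edges i := (Finset.mem_sigma.1 hiα).2
  set t : ℝ := N.vval m₁ i α / N.vval m₂ i α with ht
  have hzero : ∀ β, ∀ y ∈ Icc (0:ℝ) (N.ℓ β), m₁ β y - t * m₂ β y = 0 := by
    refine (hL₁.sub_mul hL₂ t).eq_zero hμ hγ hb (fun j β hβ => ?_) hα ?_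
    · rw [Network.vval_sub_mul, sub_nonneg, ← le_div_iff₀ (hpos j β hβ)]
      exact hmin ⟨j, β⟩ (Finset.mem_sigma.2 ⟨Finset.mem_univ _, hβ⟩)
    · rw [Network.vval_sub_mul, ht, div_mul_cancel₀ _ (hpos i α hα).ne', sub_self]
  have ht1 : t = 1 := by
    rw [← hmass₁, ← mul_one t, ← hmass₂, Finset.mul_sum]
    refine Finset.sum_congr rfl fun β _ => ?_
    rw [← intervalIntegral.integral_const_mul]
    refine intervalIntegral.integral_congr fun y hy => ?_
    rw [uIcc_of_le (N.ℓ_pos β).le] at hy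
    exact (sub_eq_zero.1 (hzero β y hy)).symm
  intro y hy
  simpa [ht1, sub_eq_zero] using hzero α₀ y hy
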